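/- Let M be an infinite metric space that is not uniformly discrete (i.e., inf{R(x) : x ∈ M} = 0, where R(x) = inf{d(x,y) : y ≠ x}). Then SNA(M) contains a linear subspace isometrically isomorphic to c₀; i.e., there is a sequence (f_k) of strongly norm-attaining Lipschitz functions vanishing at the base point such that ‖Σ λ_k f_k‖ = max|λ_k| for all (λ_k) ∈ c₀, and every nonzero function in the closed span strongly attains its Lipschitz norm. -/

import Mathlib

open Filter

/-- `L` is the (least) Lipschitz norm of `f`. -/
def LipNormEq {M : Type*} [MetricSpace M] (f : M → ℝ) (L : ℝ) : Prop :=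
  (∀ p q : M, |f p - f q| ≤ L * dist p q) ∧
  ∀ L' : ℝ, 0 ≤ L' → (∀ p q : M, |f p - f q| ≤ L' * dist p q) → L ≤ L'

/-- two-sided bump -/
noncomputable def tsBump {M : Type*} [MetricSpace M] (u v : M) (a b : ℝ) (z : M) : ℝ :=
  max 0 (a - dist z u) - max 0 (b - dist z v)

lemma tsBump_lip {M : Type*} [MetricSpace M] (u v : M) (a b : ℝ) (h : a + b = dist u v) (p q : M) :
    |tsBump u v a b p - tsBump u v a b q| ≤ dist p q := by
  have h1 := dist_triangle_left u v p
  have h2 := dist_triangle_left u v q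
  have h3 := dist_triangle p q u
  have h4 := dist_triangle p q v
  have h5 := dist_triangle q p u
  have h6 := dist_triangle q p v
  have h0 := dist_comm p q
  have h7 : (0:ℝ) ≤ dist p q := dist_nonneg
  unfold tsBump
  rw [abs_le]
  constructor <;>
  rcases max_cases 0 (a - dist p u) with ⟨e1, e1'⟩ | ⟨e1, e1'⟩ <;>
  rcases max_cases 0 (b - dist p v) with ⟨e2, e2'⟩ | ⟨e2, e2'⟩ <;>
  rcases max_cases 0 (a - dist q u) with ⟨e3, e3'⟩ | ⟨e3, e3'⟩ <;>
  rcases max_cases 0 (b - dist q v) with ⟨e4, e4'⟩ | ⟨e4, e4'⟩ <;>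
  rw [e1, e2, e3, e4] <;> linarith

lemma tsBump_abs {M : Type*} [MetricSpace M] (u v : M) (a b : ℝ) (z : M)
    (hz : tsBump u v a b z ≠ 0) :
    |tsBump u v a b z| ≤ a - dist z u ∨ |tsBump u v a b z| ≤ b - dist z v := by
  unfold tsBump at *
  rcases max_cases 0 (a - dist z u) with ⟨e1, e1'⟩ | ⟨e1, e1'⟩ <;>
  rcases max_cases 0 (b - dist z v) with ⟨e2, e2'⟩ | ⟨e2, e2'⟩ <;>
  rw [e1, e2] at hz ⊢
  · simp at hz
  · right; rw [abs_le]; constructor <;> linarith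
  · left; rw [abs_le]; constructor <;> linarith
  · rcases le_total (a - dist z u) (b - dist z v) with h | h
    · right; rw [abs_le]; constructor <;> linarith
    · left; rw [abs_le]; constructor <;> linarith

lemma core {M : Type*} [MetricSpace M] (z₀ : M) (g : ℕ → M → ℝ)
    (hlip : ∀ k p q, |g k p - g k q| ≤ dist p q)
    (hdis : ∀ j k, j ≠ k → ∀ p q, g j p ≠ 0 → g k q ≠ 0 → |g j p| + |g k q| ≤ dist p q)
    (p q : ℕ → M) (hpq : ∀ k, p k ≠ q k)
    (hatt : ∀ k, |g k (p k) - g k (q k)| = dist (p k) (q k))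
    (hp : ∀ j k, j ≠ k → g j (p k) = 0) (hq : ∀ j k, j ≠ k → g j (q k) = 0) :
    ∃ f : ℕ → M → ℝ,
      (∀ k, f k z₀ = 0) ∧
      ∀ lam : ℕ → ℝ, Tendsto lam atTop (nhds 0) →
        LipNormEq (fun z => ∑' k, lam k * f k z) (⨆ k, |lam k|) ∧
        (lam ≠ 0 → ∃ p q : M, p ≠ q ∧
          |(∑' k, lam k * f k p) - (∑' k, lam k * f k q)| = (⨆ k, |lam k|) * dist p q) := by
  refine ⟨fun k z => g k z - g k z₀, fun k => by simp, fun lam hlam => ?_⟩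
  have hone : ∀ z, ∃ k, ∀ j, j ≠ k → g j z = 0 := by
    intro z
    by_cases hz : ∃ k, g k z ≠ 0
    · obtain ⟨k, hk⟩ := hz
      refine ⟨k, fun j hj => ?_⟩
      by_contra hne
      have := hdis j k hj z z hne hk
      rw [dist_self] at this
      have h1 := abs_pos.2 hne
      have h2 := abs_pos.2 hk
      linarith
    · push Not at hz
      exact ⟨0, fun j _ => hz j⟩
  have hsum : ∀ z, Summable (fun k => lam k * g k z) := by
    intro z
    obtain ⟨k, hk⟩ := hone z
    refine summable_of_ne_finset_zero (s := {k}) (fun j hj => ?_)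
    rw [hk j (by simpa using hj), mul_zero]
  have hval : ∀ z k, (∀ j, j ≠ k → g j z = 0) → ∑' k, lam k * g k z = lam k * g k z := by
    intro z k hk
    exact tsum_eq_single k (fun j hj => by rw [hk j hj, mul_zero])
  have hdiff : ∀ x y, (∑' k, lam k * (g k x - g k z₀)) - (∑' k, lam k * (g k y - g k z₀))
      = (∑' k, lam k * g k x) - ∑' k, lam k * g k y := by
    intro x y
    simp only [mul_sub]
    rw [(hsum x).tsum_sub (hsum z₀), (hsum y).tsum_sub (hsum z₀)]
    ring
  have hbdd : BddAbove (Set.range fun k => |lam k|) := hlam.abs.bddAbove_range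
  have hle : ∀ k, |lam k| ≤ ⨆ k, |lam k| := fun k => le_ciSup hbdd k
  have hpk : ∀ k, |(∑' j, lam j * g j (p k)) - ∑' j, lam j * g j (q k)|
      = |lam k| * dist (p k) (q k) := by
    intro k
    rw [hval (p k) k (fun j hj => hp j k hj), hval (q k) k (fun j hj => hq j k hj), ← mul_sub,
      abs_mul, hatt]
  have hsame : ∀ x y k, (∀ j, j ≠ k → g j x = 0) → (∀ j, j ≠ k → g j y = 0) →
      |(∑' j, lam j * g j x) - ∑' j, lam j * g j y| ≤ (⨆ k, |lam k|) * dist x y := by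
    intro x y k hx hy
    rw [hval x k hx, hval y k hy, ← mul_sub, abs_mul]
    exact mul_le_mul (hle k) (hlip k x y) (abs_nonneg _) ((abs_nonneg _).trans (hle k))
  refine ⟨⟨fun x y => ?_, fun L' _ hL' => ?_⟩, fun hne => ?_⟩
  · simp only [hdiff]
    obtain ⟨i, hi⟩ := hone x
    obtain ⟨j, hj⟩ := hone y
    by_cases hij : i = j
    · subst hij
      exact hsame x y i hi hj
    by_cases hx0 : g i x = 0
    · refine hsame x y j (fun l _ => ?_) hj
      by_cases hl : l = i
      · rw [hl, hx0]
      · exact hi l hl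
    by_cases hy0 : g j y = 0
    · refine hsame x y i hi (fun l _ => ?_)
      by_cases hl : l = j
      · rw [hl, hy0]
      · exact hj l hl
    have hd := hdis i j hij x y hx0 hy0
    rw [hval x i hi, hval y j hj]
    have hL : 0 ≤ ⨆ k, |lam k| := (abs_nonneg _).trans (hle 0)
    calc |lam i * g i x - lam j * g j y| ≤ |lam i * g i x| + |lam j * g j y| := abs_sub _ _
      _ = |lam i| * |g i x| + |lam j| * |g j y| := by rw [abs_mul, abs_mul]
      _ ≤ (⨆ k, |lam k|) * |g i x| + (⨆ k, |lam k|) * |g j y| := by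
        gcongr
        · exact hle i
        · exact hle j
      _ = (⨆ k, |lam k|) * (|g i x| + |g j y|) := by ring
      _ ≤ _ := by gcongr
  · refine ciSup_le (fun k => ?_)
    have := hL' (p k) (q k)
    simp only [hdiff] at this
    rw [hpk] at this
    exact le_of_mul_le_mul_right this (dist_pos.2 (hpq k))
  · obtain ⟨k₀, hk₀⟩ : ∃ k, lam k ≠ 0 := by
      by_contra hcon
      push Not at hcon
      exact hne (funext hcon)
    have hev : ∀ᶠ k in cocompact ℕ, |lam k| ≤ |lam k₀| := by
      rw [cocompact_eq_cofinite, Nat.cofinite_eq_atTop]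
      have h0 : Tendsto (fun k => |lam k|) atTop (nhds 0) := by simpa using hlam.abs
      exact h0.eventually (Iic_mem_nhds (abs_pos.2 hk₀))
    obtain ⟨k, hk⟩ := (continuous_of_discreteTopology (f := fun k : ℕ => |lam k|)).exists_forall_ge'
      k₀ hev
    refine ⟨p k, q k, hpq k, ?_⟩
    rw [hdiff, hpk, le_antisymm (hle k) (ciSup_le hk)]

lemma core2 {M : Type*} [MetricSpace M] (z₀ : M) (u v : ℕ → M) (a b : ℕ → ℝ)
    (ha : ∀ k, 0 ≤ a k) (hb : ∀ k, 0 ≤ b k) (huv : ∀ k, u k ≠ v k)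
    (hab : ∀ k, a k + b k = dist (u k) (v k))
    (hlt : ∀ j k, j < k → a j + a k ≤ dist (u j) (u k) ∧ a j + b k ≤ dist (u j) (v k) ∧
      b j + a k ≤ dist (v j) (u k) ∧ b j + b k ≤ dist (v j) (v k)) :
    ∃ f : ℕ → M → ℝ,
      (∀ k, f k z₀ = 0) ∧
      ∀ lam : ℕ → ℝ, Tendsto lam atTop (nhds 0) →
        LipNormEq (fun z => ∑' k, lam k * f k z) (⨆ k, |lam k|) ∧
        (lam ≠ 0 → ∃ p q : M, p ≠ q ∧
          |(∑' k, lam k * f k p) - (∑' k, lam k * f k q)| = (⨆ k, |lam k|) * dist p q) := by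
  have hne : ∀ j k, j ≠ k → a j + a k ≤ dist (u j) (u k) ∧ a j + b k ≤ dist (u j) (v k) ∧
      b j + a k ≤ dist (v j) (u k) ∧ b j + b k ≤ dist (v j) (v k) := by
    intro j k hjk
    rcases lt_or_gt_of_ne hjk with h | h
    · exact hlt j k h
    · obtain ⟨h1, h2, h3, h4⟩ := hlt k j h
      rw [dist_comm (u j) (u k), dist_comm (u j), dist_comm (v j), dist_comm (v j)]
      refine ⟨?_, ?_, ?_, ?_⟩ <;> linarith
  refine core z₀ (fun k => tsBump (u k) (v k) (a k) (b k))
    (fun k p q => tsBump_lip _ _ _ _ (hab k) p q) ?_ u v huv ?_ ?_ ?_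
  · intro j k hjk p q hp hq
    obtain ⟨h1, h2, h3, h4⟩ := hne j k hjk
    rcases tsBump_abs _ _ _ _ _ hp with h | h <;> rcases tsBump_abs _ _ _ _ _ hq with h' | h'
    · have := dist_triangle4 (u j) p q (u k)
      rw [dist_comm (u j) p] at this
      linarith
    · have := dist_triangle4 (u j) p q (v k)
      rw [dist_comm (u j) p] at this
      linarith
    · have := dist_triangle4 (v j) p q (u k)
      rw [dist_comm (v j) p] at this
      linarith
    · have := dist_triangle4 (v j) p q (v k)
      rw [dist_comm (v j) p] at this
      linarith
  · intro k
    have := hab k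
    have h1 := ha k
    have h2 := hb k
    have h3 : (0:ℝ) ≤ dist (u k) (v k) := dist_nonneg
    simp only [tsBump, dist_self, sub_zero]
    rw [dist_comm (v k) (u k), max_eq_right h1, max_eq_right h2, max_eq_left (by linarith),
      max_eq_left (by linarith), ← this, abs_of_nonneg] <;> linarith
  · intro j k hjk
    obtain ⟨h1, h2, h3, h4⟩ := hne k j hjk.symm
    have := ha k
    simp only [tsBump]
    rw [max_eq_left (by linarith), max_eq_left (by linarith), sub_zero]
  · intro j k hjk
    obtain ⟨h1, h2, h3, h4⟩ := hne k j hjk.symm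
    have := hb k
    simp only [tsBump]
    rw [max_eq_left (by linarith), max_eq_left (by linarith), sub_zero]

lemma caseA {M : Type*} [MetricSpace M] (x : M)
    (h : ∀ δ > (0:ℝ), ∃ u v : M, u ≠ x ∧ v ≠ x ∧ u ≠ v ∧ dist u x < δ ∧ dist v x < δ ∧
      dist u v < dist u x + dist v x) :
    ∃ (u v : ℕ → M) (a b : ℕ → ℝ), (∀ k, 0 ≤ a k) ∧ (∀ k, 0 ≤ b k) ∧ (∀ k, u k ≠ v k) ∧
    (∀ k, a k + b k = dist (u k) (v k)) ∧
    (∀ j k, j < k → a j + a k ≤ dist (u j) (u k) ∧ a j + b k ≤ dist (u j) (v k) ∧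
      b j + a k ≤ dist (v j) (u k) ∧ b j + b k ≤ dist (v j) (v k)) := by
  have step : ∀ δ : {δ : ℝ // 0 < δ}, ∃ (u v : M) (a b : ℝ) (s : {δ : ℝ // 0 < δ}),
      0 ≤ a ∧ 0 ≤ b ∧ u ≠ v ∧ a + b = dist u v ∧ a ≤ dist u x - 2 * s ∧ b ≤ dist v x - 2 * s ∧
      dist u x ≤ δ ∧ dist v x ≤ δ ∧ s.1 ≤ δ.1 := by
    rintro ⟨δ, hδ⟩
    obtain ⟨u, v, hu, hv, huv, hud, hvd, hlt⟩ := h δ hδ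
    have hu' := dist_pos.2 hu
    have hv' := dist_pos.2 hv
    have huv' := dist_pos.2 huv
    obtain ⟨s, hs, hs1, hs2, hs3⟩ : ∃ s : ℝ, 0 < s ∧ 4 * s ≤ dist u x ∧ 4 * s ≤ dist v x ∧
        4 * s ≤ dist u x + dist v x - dist u v := by
      refine ⟨min (min (dist u x) (dist v x)) (dist u x + dist v x - dist u v) / 4, ?_, ?_, ?_, ?_⟩
      · have : 0 < min (min (dist u x) (dist v x)) (dist u x + dist v x - dist u v) :=
          lt_min (lt_min hu' hv') (by linarith)
        linarith
      · have := (min_le_left (min (dist u x) (dist v x)) (dist u x + dist v x - dist u v)).trans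
          (min_le_left _ _)
        linarith
      · have := (min_le_left (min (dist u x) (dist v x)) (dist u x + dist v x - dist u v)).trans
          (min_le_right _ _)
        linarith
      · have := (min_le_right (min (dist u x) (dist v x)) (dist u x + dist v x - dist u v))
        linarith
    have hA : 0 < dist u x - 2 * s := by linarith
    have hB : 0 < dist v x - 2 * s := by linarith
    have hD : 0 < (dist u x - 2 * s) + (dist v x - 2 * s) := by linarith
    set D := (dist u x - 2 * s) + (dist v x - 2 * s) with hDdef
    have ht0 : 0 < dist u v / D := div_pos huv' hD
    have ht1 : dist u v / D ≤ 1 := by rw [div_le_one hD]; linarith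
    refine ⟨u, v, dist u v / D * (dist u x - 2 * s), dist u v / D * (dist v x - 2 * s), ⟨s, hs⟩,
      by positivity, by positivity, huv, ?_, ?_, ?_, hud.le, hvd.le, ?_⟩
    · rw [← mul_add, ← hDdef, div_mul_cancel₀ _ hD.ne']
    · exact mul_le_of_le_one_left hA.le ht1
    · exact mul_le_of_le_one_left hB.le ht1
    · show s ≤ δ
      linarith
  choose U V A B S hA hB hUV hAB hA2 hB2 hU hV hS using step
  let d : ℕ → {δ : ℝ // 0 < δ} := fun n => S^[n] ⟨1, one_pos⟩
  have hd : ∀ n, d (n + 1) = S (d n) := fun n => Function.iterate_succ_apply' S n _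
  have hanti : Antitone d := antitone_nat_of_succ_le (fun n => by rw [hd]; exact hS _)
  refine ⟨fun k => U (d k), fun k => V (d k), fun k => A (d k), fun k => B (d k), fun k => hA _,
    fun k => hB _, fun k => hUV _, fun k => hAB _, fun j k hjk => ?_⟩
  have hk : (d k : ℝ) ≤ S (d j) := by
    rw [← hd]; exact hanti hjk
  have s1 := hA2 (d j)
  have s2 := hB2 (d j)
  have s3 := hA2 (d k)
  have s4 := hB2 (d k)
  have s5 := hU (d k)
  have s6 := hV (d k)
  have s7 := (S (d k)).2
  have t1 := dist_triangle (U (d j)) (U (d k)) x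
  have t2 := dist_triangle (U (d j)) (V (d k)) x
  have t3 := dist_triangle (V (d j)) (U (d k)) x
  have t4 := dist_triangle (V (d j)) (V (d k)) x
  refine ⟨?_, ?_, ?_, ?_⟩ <;> dsimp only <;> linarith

lemma caseC {M : Type*} [MetricSpace M] [CompleteSpace M]
    (hnud : ∀ ε > (0 : ℝ), ∃ x y : M, x ≠ y ∧ dist x y < ε)
    (hiso : ∀ x : M, ∃ δ > (0:ℝ), ∀ y, dist y x < δ → y = x) :
    ∃ ε > (0:ℝ), ∃ u v : ℕ → M, (∀ k, u k ≠ v k) ∧ (∀ k, dist (u k) (v k) ≤ ε / 4) ∧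
      ∀ j k, j < k → ε ≤ dist (u j) (u k) := by
  choose x y hxy hd using fun n : ℕ => hnud (1 / ((n:ℝ) + 1)) Nat.one_div_pos_of_nat
  have hntb : ¬ TotallyBounded (Set.range x) := by
    intro htb
    have hc : IsCompact (closure (Set.range x)) :=
      isCompact_iff_totallyBounded_isComplete.2 ⟨htb.closure, isClosed_closure.isComplete⟩
    obtain ⟨z, _, φ, hφ, hlim⟩ := hc.tendsto_subseq (x := x)
      (fun n => subset_closure (Set.mem_range_self n))
    obtain ⟨δ, hδ, hz⟩ := hiso z
    have h1 : ∀ᶠ n in atTop, dist (x (φ n)) z < δ / 2 :=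
      hlim.eventually (Metric.ball_mem_nhds z (half_pos hδ))
    have h2 : ∀ᶠ n in atTop, 1 / ((φ n : ℝ) + 1) < δ / 2 :=
      (tendsto_one_div_add_atTop_nhds_zero_nat.comp hφ.tendsto_atTop).eventually
        (Iio_mem_nhds (half_pos hδ))
    obtain ⟨n, hn1, hn2⟩ := (h1.and h2).exists
    have e1 := hz _ (hn1.trans (half_lt_self hδ))
    have e2 : y (φ n) = z := by
      apply hz
      have := dist_triangle_left (y (φ n)) z (x (φ n))
      have := hd (φ n)
      linarith
    exact hxy (φ n) (e1.trans e2.symm)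
  rw [Metric.totallyBounded_iff] at hntb
  push Not at hntb
  obtain ⟨ε, hε, hcov⟩ := hntb
  obtain ⟨N, hN⟩ := exists_nat_one_div_lt (show (0:ℝ) < ε / 4 by positivity)
  obtain ⟨f, hf1, hf2⟩ := exists_seq_of_forall_finset_exists (fun m : ℕ => N ≤ m)
    (fun m n => ε ≤ dist (x m) (x n)) (by
      intro s _
      have := hcov (x '' (s ∪ Finset.range N : Finset ℕ)) ((Finset.finite_toSet _).image _)
      rw [Set.not_subset] at this
      obtain ⟨_, ⟨m, rfl⟩, hm⟩ := this
      have hm' : ∀ i ∈ s ∪ Finset.range N, ε ≤ dist (x i) (x m) := by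
        intro i hi
        by_contra hlt
        push Not at hlt
        apply hm
        simp only [Set.mem_iUnion]
        exact ⟨x i, ⟨i, hi, rfl⟩, by rwa [Metric.mem_ball, dist_comm]⟩
      refine ⟨m, ?_, fun i hi => hm' i (Finset.mem_union_left _ hi)⟩
      by_contra hlt
      push Not at hlt
      have := hm' m (Finset.mem_union_right _ (Finset.mem_range.2 hlt))
      rw [dist_self] at this
      linarith)
  refine ⟨ε, hε, fun k => x (f k), fun k => y (f k), fun k => hxy _, fun k => ?_, hf2⟩
  have h1 := hd (f k)
  have h2 : 1 / ((f k : ℝ) + 1) ≤ 1 / ((N : ℝ) + 1) := Nat.one_div_le_one_div (hf1 k)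
  linarith

theorem stmt9 {M : Type*} [MetricSpace M] [CompleteSpace M] [Infinite M] (z₀ : M)
    (hnud : ∀ ε > (0 : ℝ), ∃ x y : M, x ≠ y ∧ dist x y < ε) :
    ∃ f : ℕ → M → ℝ,
      (∀ k, f k z₀ = 0) ∧
      ∀ lam : ℕ → ℝ, Tendsto lam atTop (nhds 0) →
        LipNormEq (fun z => ∑' k, lam k * f k z) (⨆ k, |lam k|) ∧
        (lam ≠ 0 → ∃ p q : M, p ≠ q ∧
          |(∑' k, lam k * f k p) - (∑' k, lam k * f k q)| = (⨆ k, |lam k|) * dist p q) := by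
  by_cases hiso : ∀ x : M, ∃ δ > (0:ℝ), ∀ y, dist y x < δ → y = x
  · obtain ⟨ε, hε, u, v, huv, hd, hsep⟩ := caseC hnud hiso
    refine core2 z₀ u v (fun k => dist (u k) (v k)) (fun _ => 0) (fun _ => dist_nonneg)
      (fun _ => le_rfl) huv (fun k => by simp) (fun j k hjk => ?_)
    have h1 := hd j
    have h2 := hd k
    have h3 := hsep j k hjk
    have h4 := dist_triangle_right (u j) (u k) (v k)
    have h5 := dist_triangle_left (u j) (u k) (v j)
    have h6 := dist_comm (v j) (u j)
    have h7 : (0:ℝ) ≤ dist (v j) (v k) := dist_nonneg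
    refine ⟨?_, ?_, ?_, ?_⟩ <;> linarith
  · push Not at hiso
    obtain ⟨x, hx⟩ := hiso
    by_cases h : ∀ δ > (0:ℝ), ∃ u v : M, u ≠ x ∧ v ≠ x ∧ u ≠ v ∧ dist u x < δ ∧ dist v x < δ ∧
      dist u v < dist u x + dist v x
    · obtain ⟨u, v, a, b, ha, hb, huv, hab, hlt⟩ := caseA x h
      exact core2 z₀ u v a b ha hb huv hab hlt
    · push Not at h
      obtain ⟨δ, hδ, h⟩ := h
      obtain ⟨u, hu1, hu2⟩ := exists_seq_of_forall_finset_exists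
        (fun u : M => u ≠ x ∧ dist u x < δ) (fun u v => u ≠ v) (by
          intro s hs
          have : ∃ η > (0:ℝ), η ≤ δ ∧ ∀ w ∈ s, η ≤ dist w x := by
            clear h
            classical
            induction s using Finset.induction_on with
            | empty => exact ⟨δ, hδ, le_rfl, by simp⟩
            | insert w s hw ih =>
              obtain ⟨η, hη, hη1, hη2⟩ := ih (fun w' hw' => hs w' (Finset.mem_insert_of_mem hw'))
              have hw0 := dist_pos.2 (hs w (Finset.mem_insert_self _ _)).1
              refine ⟨min η (dist w x), lt_min hη hw0, (min_le_left _ _).trans hη1, ?_⟩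
              intro w' hw'
              rcases Finset.mem_insert.1 hw' with rfl | hw'
              · exact min_le_right _ _
              · exact (min_le_left _ _).trans (hη2 w' hw')
          obtain ⟨η, hη, hη1, hη2⟩ := this
          obtain ⟨y, hy1, hy2⟩ := hx η hη
          refine ⟨y, ⟨hy2, hy1.trans_le hη1⟩, ?_⟩
          rintro w hw rfl
          exact absurd hy1 (not_lt.2 (hη2 _ hw)))
      refine core2 z₀ u (fun _ => x) (fun k => dist (u k) x) (fun _ => 0) (fun _ => dist_nonneg)
        (fun _ => le_rfl) (fun k => (hu1 k).1) (fun k => by simp) (fun j k hjk => ?_)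
      refine ⟨h _ _ (hu1 j).1 (hu1 k).1 (hu2 j k hjk) (hu1 j).2 (hu1 k).2, ?_, ?_, ?_⟩
      · simp
      · simp [dist_comm]
      · simp
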